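/- Let u₀,u₁,v be unit vectors of ℂ² with ⟨v,u₀⟩ ≠ 0, and let ρ₀,ρ₁,τ₀ be nonzero complex numbers such that: 0 < |ρ₀| < 1; (|ρ₀|²/(1−|ρ₀|²))·⟨u₀,u₁⟩·⟨v,u₀⟩ + ⟨v,u₁⟩ = 0; |ρ₁|² = (1−|ρ₀|²)/(1 + (|ρ₀|²/(1−|ρ₀|²))·|⟨v,u₀⟩|²); and |τ₀|² = 1/(1 + (|ρ₀|²/(1−|ρ₀|²))·|⟨u₁,u₀⟩|²). Set r := −(conj(ρ₀)/conj(ρ₁))·⟨v,u₀⟩/(1 + (|ρ₀|²/(1−|ρ₀|²))·|⟨v,u₀⟩|²) and τ₁ := τ₀·ρ₁·⟨u₁,v⟩/(ρ₀·⟨u₀,v⟩). Define a⁰,a¹ : ℕ → ℂ² by a⁰₀ := ρ₀·u₀, a⁰_k := ρ₁·r^{k−1}·v for k ≥ 1, a¹₀ := τ₀·u₁, a¹_k := τ₁·r^{k−1}·v for k ≥ 1 (the Type 5 family). Then |r| < 1 and a⁰,a¹ satisfy condition (A) and conditions (C1)–(C5). -/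

import Mathlib

open Finset

/-- `ℂ²` with its Euclidean structure. -/
abbrev E2 := EuclideanSpace ℂ (Fin 2)

/-- The inner product of `ℂ²`: `⟨u,v⟩ = u⁽¹⁾conj(v⁽¹⁾) + u⁽²⁾conj(v⁽²⁾)`. -/
noncomputable def cinner (u v : E2) : ℂ := ∑ i, u i * (starRingEnd ℂ) (v i)

/-- Condition (A). -/
def condA (a0 a1 : ℕ → E2) : Prop :=
  (∀ m : ℕ, (∑' k : ℕ, cinner (a0 (k + m)) (a0 k)) = if m = 0 then 1 else 0) ∧
  (∀ m : ℕ, (∑' k : ℕ, cinner (a1 (k + m)) (a1 k)) = if m = 0 then 1 else 0) ∧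
  (∀ m : ℕ, (∑' k : ℕ, cinner (a0 (k + m)) (a1 k)) = 0) ∧
  (∀ m : ℕ, (∑' k : ℕ, cinner (a1 (k + m)) (a0 k)) = 0)

/-- Conditions (C1)–(C5), with `d := 1 − ‖a0 0‖²`. -/
def condC (a0 a1 : ℕ → E2) : Prop :=
  (∀ p : ℕ, 1 ≤ p → ‖cinner (a0 p) (a0 0)‖ ^ 2
      = (1 - ‖a0 0‖ ^ 2) * (1 - ∑ k ∈ Finset.range (p + 1), ‖a0 k‖ ^ 2)) ∧
  (∀ p : ℕ, ‖cinner (a1 p) (a0 0)‖ ^ 2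
      = (1 - ‖a0 0‖ ^ 2) * (1 - ∑ k ∈ Finset.range (p + 1), ‖a1 k‖ ^ 2)) ∧
  (∀ p p' : ℕ, 0 < p → p < p' →
    cinner (a0 p') (a0 0) * cinner (a0 0) (a0 p)
      = -((1 - ‖a0 0‖ ^ 2 : ℝ) : ℂ) *
          ∑ r ∈ Finset.range (p + 1), cinner (a0 (p' - r)) (a0 (p - r))) ∧
  (∀ p p' : ℕ, p < p' →
    cinner (a1 p') (a0 0) * cinner (a0 0) (a1 p)
      = -((1 - ‖a0 0‖ ^ 2 : ℝ) : ℂ) *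
          ∑ r ∈ Finset.range (p + 1), cinner (a1 (p' - r)) (a1 (p - r))) ∧
  (∀ p p' : ℕ, 0 < p → p ≤ p' →
    cinner (a1 p') (a0 0) * cinner (a0 0) (a0 p)
      = -((1 - ‖a0 0‖ ^ 2 : ℝ) : ℂ) *
          ∑ r ∈ Finset.range (p + 1), cinner (a1 (p' - r)) (a0 (p - r))) ∧
  (∀ p p' : ℕ, p' < p →
    cinner (a1 p') (a0 0) * cinner (a0 0) (a0 p)
      = -((1 - ‖a0 0‖ ^ 2 : ℝ) : ℂ) *
          ∑ r ∈ Finset.range (p' + 1), cinner (a1 (p' - r)) (a0 (p - r)))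

open ComplexConjugate Filter Topology

lemma cinner_smul_left (c : ℂ) (x y : E2) : cinner (c • x) y = c * cinner x y := by
  simp [cinner, mul_add, mul_assoc]

lemma conj_cinner (x y : E2) : conj (cinner x y) = cinner y x := by
  simp [cinner, mul_comm]

lemma cinner_smul_right (c : ℂ) (x y : E2) : cinner x (c • y) = conj c * cinner x y := by
  rw [← conj_cinner, cinner_smul_left, map_mul, conj_cinner]

lemma cinner_self (x : E2) : cinner x x = ((‖x‖ ^ 2 : ℝ) : ℂ) := by
  rw [EuclideanSpace.norm_sq_eq]
  simp [cinner, Complex.mul_conj, Complex.normSq_eq_norm_sq]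

lemma ofReal_norm_cinner_sq (x y : E2) :
    ((‖cinner x y‖ ^ 2 : ℝ) : ℂ) = cinner x y * cinner y x := by
  rw [← conj_cinner x y, Complex.mul_conj, Complex.normSq_eq_norm_sq]

section Geometric

variable {v : E2} {a b : ℕ → E2} {α β r K δ : ℂ}

/-- Partial correlation sums of two sequences that are geometric multiples of `v` from the
first index on. -/
lemma sum_cinner_shift (ha : ∀ k, a (k + 1) = (α * r ^ k) • v)
    (hb : ∀ k, b (k + 1) = (β * r ^ k) • v) (hv : cinner v v = 1)
    (hK : K * (1 - r * conj r) = 1) (h0 : cinner (a 0) (b 0) = δ - K * α * conj β)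
    (hvb : cinner v (b 0) = -(K * conj β * r)) (m n : ℕ) :
    ∑ j ∈ Finset.range (n + 1), cinner (a (j + m)) (b j)
      = (if m = 0 then δ else 0) - K * α * conj β * r ^ m * (r * conj r) ^ n := by
  induction n with
  | zero =>
    rcases m with _ | m
    · simp [h0]
    · simp only [zero_add, Finset.sum_range_one, ha, cinner_smul_left, hvb]
      simp
      ring
  | succ n ih =>
    rw [Finset.sum_range_succ, ih, show n + 1 + m = (n + m) + 1 by ring, ha, hb,
      cinner_smul_left, cinner_smul_right, hv]
    simp only [map_mul, map_pow]
    linear_combination (-(α * conj β * r ^ m * (r * conj r) ^ n)) * hK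

lemma tsum_cinner_shift (ha : ∀ k, a (k + 1) = (α * r ^ k) • v)
    (hb : ∀ k, b (k + 1) = (β * r ^ k) • v) (hv : cinner v v = 1) (hr : ‖r‖ < 1)
    (hK : K * (1 - r * conj r) = 1) (h0 : cinner (a 0) (b 0) = δ - K * α * conj β)
    (hvb : cinner v (b 0) = -(K * conj β * r)) (m : ℕ) :
    ∑' k, cinner (a (k + m)) (b k) = if m = 0 then δ else 0 := by
  have hq : ‖r * conj r‖ < 1 := by
    rw [norm_mul, RCLike.norm_conj]
    nlinarith [norm_nonneg r]
  have hs : Summable fun k => cinner (a (k + m)) (b k) := by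
    rw [← summable_nat_add_iff 1]
    refine ((summable_geometric_of_norm_lt_one hq).mul_left (α * conj β * r ^ m)).congr ?_
    intro k
    rw [show k + 1 + m = (k + m) + 1 by ring, ha, hb, cinner_smul_left, cinner_smul_right, hv]
    simp only [map_mul, map_pow]
    ring
  have ht := (tendsto_add_atTop_iff_nat 1).2 hs.hasSum.tendsto_sum_nat
  simp only [sum_cinner_shift ha hb hv hK h0 hvb] at ht
  refine tendsto_nhds_unique ht ?_
  simpa using ((tendsto_pow_atTop_nhds_zero_of_norm_lt_one hq).const_mul
    (K * α * conj β * r ^ m)).const_sub (if m = 0 then δ else 0)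

lemma sum_cinner_sub (ha : ∀ k, a (k + 1) = (α * r ^ k) • v)
    (hb : ∀ k, b (k + 1) = (β * r ^ k) • v) (hv : cinner v v = 1)
    (hK : K * (1 - r * conj r) = 1) (h0 : cinner (a 0) (b 0) = δ - K * α * conj β)
    (hvb : cinner v (b 0) = -(K * conj β * r)) (m n : ℕ) :
    ∑ j ∈ Finset.range (n + 1), cinner (a (n + m - j)) (b (n - j))
      = (if m = 0 then δ else 0) - K * α * conj β * r ^ m * (r * conj r) ^ n := by
  rw [← sum_cinner_shift ha hb hv hK h0 hvb,
    ← Finset.sum_range_reflect (fun j => cinner (a (j + m)) (b j)) (n + 1)]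
  refine Finset.sum_congr rfl fun j hj => ?_
  have := Finset.mem_range.1 hj
  rw [show n + 1 - 1 - j + m = n + m - j by omega, show n + 1 - 1 - j = n - j by omega]

/-- The product of the coefficients along `e` is `d` times the tail of the correlation series. -/
lemma cinner_mul_cinner_eq_tail {e : E2} {d : ℂ} (ha : ∀ k, a (k + 1) = (α * r ^ k) • v)
    (hb : ∀ k, b (k + 1) = (β * r ^ k) • v)
    (hd : cinner v e * cinner e v = d * K * (r * conj r)) {m n : ℕ}
    (h : n ≠ 0 ∨ m ≠ 0 ∧ cinner v e * cinner e (b 0) = d * K * conj β * r) :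
    cinner (a (n + m)) e * cinner e (b n)
      = d * (K * α * conj β * r ^ m * (r * conj r) ^ n) := by
  rcases n with _ | n
  · obtain ⟨hm, hb0⟩ := h.resolve_left (by simp)
    obtain ⟨m, rfl⟩ := Nat.exists_eq_add_one_of_ne_zero hm
    rw [zero_add, ha, cinner_smul_left]
    linear_combination (α * r ^ m) * hb0
  · rw [show n + 1 + m = (n + m) + 1 by ring, ha, hb, cinner_smul_left, cinner_smul_right]
    simp only [map_mul, map_pow]
    linear_combination (α * conj β * r ^ m * (r * conj r) ^ n) * hd

/-- Partial sums of squared norms, in terms of the coefficients along `e`. -/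
lemma norm_cinner_sq_eq {e : E2} {d : ℝ} {n : ℕ}
    (hsum : ∑ j ∈ Finset.range (n + 1), cinner (a (j + 0)) (a j)
      = 1 - K * α * conj α * r ^ 0 * (r * conj r) ^ n)
    (htail : cinner (a (n + 0)) e * cinner e (a n)
      = d * (K * α * conj α * r ^ 0 * (r * conj r) ^ n)) :
    ‖cinner (a n) e‖ ^ 2 = d * (1 - ∑ k ∈ Finset.range (n + 1), ‖a k‖ ^ 2) := by
  apply Complex.ofReal_injective
  rw [ofReal_norm_cinner_sq]
  simp only [add_zero, cinner_self] at hsum htail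
  rw [Complex.ofReal_mul, Complex.ofReal_sub, Complex.ofReal_sum, hsum, htail]
  simp

end Geometric

theorem stmt19 (u0 u1 v : E2) (hu0 : ‖u0‖ = 1) (hu1 : ‖u1‖ = 1) (hv : ‖v‖ = 1)
    (hvu0 : cinner v u0 ≠ 0)
    (ρ0 ρ1 τ0 : ℂ) (hρ0ne : ρ0 ≠ 0) (hρ1ne : ρ1 ≠ 0) (hτ0ne : τ0 ≠ 0)
    (hρ0a : 0 < ‖ρ0‖) (hρ0b : ‖ρ0‖ < 1)
    (hrel : ((‖ρ0‖ ^ 2 / (1 - ‖ρ0‖ ^ 2) : ℝ) : ℂ) * cinner u0 u1 * cinner v u0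
      + cinner v u1 = 0)
    (hρ1 : ‖ρ1‖ ^ 2 = (1 - ‖ρ0‖ ^ 2) /
      (1 + ‖ρ0‖ ^ 2 / (1 - ‖ρ0‖ ^ 2) * ‖cinner v u0‖ ^ 2))
    (hτ0 : ‖τ0‖ ^ 2 = 1 /
      (1 + ‖ρ0‖ ^ 2 / (1 - ‖ρ0‖ ^ 2) * ‖cinner u1 u0‖ ^ 2))
    (r τ1 : ℂ)
    (hr : r = -((starRingEnd ℂ) ρ0 / (starRingEnd ℂ) ρ1) * cinner v u0 /
      ((1 + ‖ρ0‖ ^ 2 / (1 - ‖ρ0‖ ^ 2) * ‖cinner v u0‖ ^ 2 : ℝ) : ℂ))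
    (hτ1 : τ1 = τ0 * ρ1 * cinner u1 v / (ρ0 * cinner u0 v))
    (a0 a1 : ℕ → E2)
    (ha00 : a0 0 = ρ0 • u0)
    (ha0k : ∀ k : ℕ, 1 ≤ k → a0 k = (ρ1 * r ^ (k - 1)) • v)
    (ha10 : a1 0 = τ0 • u1)
    (ha1k : ∀ k : ℕ, 1 ≤ k → a1 k = (τ1 * r ^ (k - 1)) • v) :
    ‖r‖ < 1 ∧ condA a0 a1 ∧ condC a0 a1 := by
  have hs : (‖ρ0‖ : ℂ) ^ 2 = ρ0 * conj ρ0 := (Complex.mul_conj' ρ0).symm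
  obtain ⟨D, hD⟩ : ∃ D : ℝ, D = 1 - ‖ρ0‖ ^ 2 := ⟨_, rfl⟩
  have hDpos : 0 < D := by nlinarith [norm_nonneg ρ0]
  obtain ⟨K, hKdef⟩ : ∃ K : ℝ, K = 1 + ‖ρ0‖ ^ 2 / D * ‖cinner v u0‖ ^ 2 := ⟨_, rfl⟩
  have hKpos : 0 < K := by rw [hKdef]; positivity
  rw [← hD] at hrel hρ1 hτ0 hr
  rw [← hKdef] at hρ1 hr
  have hKne : (K : ℂ) ≠ 0 := by exact_mod_cast hKpos.ne'
  have hDne : (D : ℂ) ≠ 0 := by exact_mod_cast hDpos.ne'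
  have hDC : (D : ℂ) = 1 - ρ0 * conj ρ0 := by rw [hD]; push_cast; rw [hs]
  have hKC : (K : ℂ) * D = D + ρ0 * conj ρ0 * (cinner v u0 * cinner u0 v) := by
    rw [← ofReal_norm_cinner_sq, hKdef, ← hs]
    push_cast
    field_simp
  have hρ1C : ρ1 * conj ρ1 * K = D := by
    rw [Complex.mul_conj']
    have : ‖ρ1‖ ^ 2 * K = D := by rw [hρ1]; field_simp
    exact_mod_cast this
  have hτ0C : τ0 * conj τ0 * (D + ρ0 * conj ρ0 * (cinner u1 u0 * cinner u0 u1)) = D := by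
    rw [← ofReal_norm_cinner_sq, Complex.mul_conj', ← hs]
    have : ‖τ0‖ ^ 2 * (D + ‖ρ0‖ ^ 2 * ‖cinner u1 u0‖ ^ 2) = D := by
      rw [hτ0]
      have : 0 < D + ‖ρ0‖ ^ 2 * ‖cinner u1 u0‖ ^ 2 := by positivity
      field_simp
    exact_mod_cast this
  have hrelC : ρ0 * conj ρ0 * cinner u0 u1 * cinner v u0 + D * cinner v u1 = 0 := by
    rw [← hs]
    push_cast at hrel
    field_simp at hrel
    linear_combination hrel
  have hrelC' : ρ0 * conj ρ0 * cinner u1 u0 * cinner u0 v + D * cinner u1 v = 0 := by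
    have := congrArg conj hrelC
    simp only [map_add, map_mul, conj_cinner, Complex.conj_conj, Complex.conj_ofReal,
      map_zero] at this
    linear_combination this
  have hcρ1 : conj ρ1 ≠ 0 := (map_ne_zero _).2 hρ1ne
  have hu0v : cinner u0 v ≠ 0 := by rw [← conj_cinner]; exact (map_ne_zero _).2 hvu0
  have hrK : conj ρ0 * cinner v u0 = -(K * conj ρ1 * r) := by
    rw [hr]; field_simp
  have hrK' : ρ0 * cinner u0 v = -(K * ρ1 * conj r) := by
    have := congrArg conj hrK
    simpa only [map_neg, map_mul, conj_cinner, Complex.conj_conj, Complex.conj_ofReal] using this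
  have hw : conj ρ0 * cinner v u0 * (ρ0 * cinner u0 v) = D * K * (r * conj r) := by
    rw [hrK, hrK']
    linear_combination (K * r * conj r) * hρ1C
  have hK : (K : ℂ) * (1 - r * conj r) = 1 := by
    apply mul_left_cancel₀ hDne
    linear_combination hKC + hw
  have hτ1C : D * τ1 = -(τ0 * ρ1 * conj ρ0 * cinner u1 u0) := by
    rw [hτ1]
    field_simp
    linear_combination hrelC'
  have hτ1C' : D * conj τ1 = -(conj τ0 * conj ρ1 * ρ0 * cinner u0 u1) := by
    have := congrArg conj hτ1C
    simpa only [map_neg, map_mul, conj_cinner, Complex.conj_conj, Complex.conj_ofReal] using this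
  have hrlt : ‖r‖ < 1 := by
    have hKR : K * (1 - ‖r‖ ^ 2) = 1 := by
      rw [Complex.mul_conj'] at hK
      exact_mod_cast hK
    have hpos : 0 < 1 - ‖r‖ ^ 2 := by
      refine pos_of_mul_pos_right ?_ hKpos.le
      rw [hKR]
      exact one_pos
    nlinarith [norm_nonneg r]
  have hvv : cinner v v = 1 := by simp [cinner_self, hv]
  have h00 : cinner (a0 0) (a0 0) = 1 - K * ρ1 * conj ρ1 := by
    rw [ha00, cinner_smul_left, cinner_smul_right, cinner_self, hu0]
    push_cast
    linear_combination hρ1C + hDC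
  have h10 : cinner (a1 0) (a0 0) = 0 - K * τ1 * conj ρ1 := by
    rw [ha00, ha10, cinner_smul_left, cinner_smul_right]
    apply mul_left_cancel₀ hDne
    linear_combination (K * conj ρ1) * hτ1C - τ0 * conj ρ0 * cinner u1 u0 * hρ1C
  have h01 : cinner (a0 0) (a1 0) = 0 - K * ρ1 * conj τ1 := by
    rw [← conj_cinner, h10]
    simp
    ring
  have h11 : cinner (a1 0) (a1 0) = 1 - K * τ1 * conj τ1 := by
    rw [ha10, cinner_smul_left, cinner_smul_right, cinner_self, hu1]
    push_cast
    apply mul_left_cancel₀ (mul_ne_zero hDne hDne)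
    linear_combination D * hτ0C + K * D * conj τ1 * hτ1C -
      K * τ0 * ρ1 * conj ρ0 * cinner u1 u0 * hτ1C' +
      τ0 * conj τ0 * ρ0 * conj ρ0 * cinner u1 u0 * cinner u0 u1 * hρ1C
  have hv0 : cinner v (a0 0) = -(K * conj ρ1 * r) := by
    rw [ha00, cinner_smul_right, hrK]
  have hv1 : cinner v (a1 0) = -(K * conj τ1 * r) := by
    rw [ha10, cinner_smul_right]
    apply mul_left_cancel₀ hDne
    linear_combination conj τ0 * hrelC + K * r * hτ1C' - conj τ0 * ρ0 * cinner u0 u1 * hrK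
  have ha0 : ∀ k, a0 (k + 1) = (ρ1 * r ^ k) • v := fun k => by simpa using ha0k (k + 1) (by simp)
  have ha1 : ∀ k, a1 (k + 1) = (τ1 * r ^ k) • v := fun k => by simpa using ha1k (k + 1) (by simp)
  have hd : cinner v (a0 0) * cinner (a0 0) v = D * K * (r * conj r) := by
    rw [ha00, cinner_smul_left, cinner_smul_right, hw]
  have he1 : cinner v (a0 0) * cinner (a0 0) (a1 0) = D * K * conj τ1 * r := by
    rw [hv0, h01]
    linear_combination K * conj τ1 * r * hρ1C
  have hnorm : 1 - ‖a0 0‖ ^ 2 = D := by rw [ha00, norm_smul, hu0, hD, mul_one]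
  refine ⟨hrlt, ⟨tsum_cinner_shift ha0 ha0 hvv hrlt hK h00 hv0,
    tsum_cinner_shift ha1 ha1 hvv hrlt hK h11 hv1, fun m => ?_, fun m => ?_⟩, ?_⟩
  · simpa using tsum_cinner_shift ha0 ha1 hvv hrlt hK h01 hv1 m
  · simpa using tsum_cinner_shift ha1 ha0 hvv hrlt hK h10 hv0 m
  rw [condC, hnorm]
  refine ⟨fun p hp => ?_, fun p => ?_, fun p p' hp hpp => ?_, fun p p' hpp => ?_,
    fun p p' hp hpp => ?_, fun p p' hpp => ?_⟩
  · exact norm_cinner_sq_eq (sum_cinner_shift ha0 ha0 hvv hK h00 hv0 0 p)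
      (cinner_mul_cinner_eq_tail ha0 ha0 hd (Or.inl (by omega)))
  · refine norm_cinner_sq_eq (sum_cinner_shift ha1 ha1 hvv hK h11 hv1 0 p) ?_
    rcases Nat.eq_zero_or_pos p with rfl | hp
    · rw [zero_add, h10, h01]
      linear_combination K * τ1 * conj τ1 * hρ1C
    · exact cinner_mul_cinner_eq_tail ha1 ha1 hd (Or.inl (by omega))
  · obtain ⟨m, rfl⟩ := Nat.exists_eq_add_of_lt hpp
    rw [add_assoc, sum_cinner_sub ha0 ha0 hvv hK h00 hv0,
      cinner_mul_cinner_eq_tail ha0 ha0 hd (Or.inl (by omega)), if_neg (by simp)]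
    ring
  · obtain ⟨m, rfl⟩ := Nat.exists_eq_add_of_lt hpp
    rw [add_assoc, sum_cinner_sub ha1 ha1 hvv hK h11 hv1,
      cinner_mul_cinner_eq_tail ha1 ha1 hd (Or.inr ⟨by simp, he1⟩), if_neg (by simp)]
    ring
  · obtain ⟨m, rfl⟩ := Nat.exists_eq_add_of_le hpp
    rw [sum_cinner_sub ha1 ha0 hvv hK h10 hv0,
      cinner_mul_cinner_eq_tail ha1 ha0 hd (Or.inl (by omega)), ite_self]
    ring
  · obtain ⟨m, rfl⟩ := Nat.exists_eq_add_of_lt hpp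
    have hsum := sum_cinner_sub ha0 ha1 hvv hK h01 hv1 (m + 1) p'
    have htail := cinner_mul_cinner_eq_tail (m := m + 1) (n := p') ha0 ha1 hd
      (Or.inr ⟨by simp, he1⟩)
    rw [ite_self, zero_sub] at hsum
    rw [← neg_eq_iff_eq_neg.2 hsum, ← add_assoc] at htail
    have := congrArg conj htail
    simp only [map_neg, map_mul, map_sum, conj_cinner, Complex.conj_ofReal] at this
    linear_combination this
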